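/- There is an absolute constant A such that the following holds for every integer k ≥ 2. Define D_k : [−1,1] → ℝ by D_k(x) = c_k/((1 − |x|)·log k) for |x| ≤ 1 − 1/(k²·log² k) and D_k(x) = c_k·k²·log k for 1 − 1/(k²·log² k) < |x| ≤ 1, where c_k > 0 is the normalizing constant making ∫_{−1}^{1} D_k(x) dx = 1. Then for every k-Fourier-sparse signal g and every x ∈ [−1,1], one has |g(x)|² ≤ A·k·(log k)²·2·D_k(x)·‖g‖₂²; equivalently, sup_{x ∈ [−1,1]} (1/(2·D_k(x)))·|g(x)|²/‖g‖₂² ≤ A·k·(log k)². -/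

import Mathlib

open Real MeasureTheory

/-- A finite-dimensional space of continuous functions has a point of evaluation whose squared norm
is at most the average of its dimension. -/
lemma exists_sq_norm_sum_le_integral {ι : Type*} [Fintype ι] (h : ι → ℝ → ℂ)
    (hc : ∀ i, Continuous (h i)) {a b : ℝ} (hab : a < b) :
    ∃ x ∈ Set.Icc a b, ∀ v : ι → ℂ,
      ‖∑ i, v i * h i x‖ ^ 2 ≤
        Fintype.card ι / (b - a) * ∫ t in a..b, ‖∑ i, v i * h i t‖ ^ 2 := by
  set μ := volume.restrict (Set.Icc a b) with hμ
  have hcont : ∀ v : ι → ℂ, Continuous fun t ↦ ∑ i, v i * h i t := fun v ↦ by fun_prop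
  have hmem : ∀ v : ι → ℂ, MemLp (fun t ↦ ∑ i, v i * h i t) 2 μ := fun v ↦
    (memLp_two_iff_integrable_sq_norm (hcont v).aestronglyMeasurable).2
      ((hcont v).norm.pow 2).integrableOn_Icc
  let φ : (ι → ℂ) →ₗ[ℂ] Lp ℂ 2 μ :=
    { toFun := fun v ↦ (hmem v).toLp _
      map_add' := fun v w ↦ by
        rw [← MemLp.toLp_add, MemLp.toLp_eq_toLp_iff]
        exact .of_forall fun t ↦ by simp [add_mul, Finset.sum_add_distrib]
      map_smul' := fun c v ↦ by
        rw [RingHom.id_apply, ← MemLp.toLp_const_smul, MemLp.toLp_eq_toLp_iff]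
        exact .of_forall fun t ↦ by simp [Finset.mul_sum, mul_assoc] }
  have hnorm : ∀ v, ‖φ v‖ ^ 2 = ∫ t in a..b, ‖∑ i, v i * h i t‖ ^ 2 := fun v ↦ by
    rw [intervalIntegral.integral_of_le hab.le, ← integral_Icc_eq_integral_Ioc,
      ← inner_self_eq_norm_sq (𝕜 := ℂ), L2.inner_def]
    rw [← integral_re (L2.integrable_inner _ _)]
    apply integral_congr_ae
    filter_upwards [(hmem v).coeFn_toLp] with t ht
    change RCLike.re (inner ℂ (((hmem v).toLp _) t) (((hmem v).toLp _) t)) = _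
    rw [ht, inner_self_eq_norm_sq]
  have heq : ∀ v w, φ v = φ w → Set.EqOn (fun t ↦ ∑ i, v i * h i t) (fun t ↦ ∑ i, w i * h i t)
      (Set.Icc a b) := fun v w hvw ↦
    Measure.eqOn_Icc_of_ae_eq volume hab.ne (((hmem v).toLp_eq_toLp_iff (hmem w)).1 hvw)
      (hcont v).continuousOn (hcont w).continuousOn
  let e := stdOrthonormalBasis ℂ (LinearMap.range φ)
  have hn : (Module.finrank ℂ (LinearMap.range φ) : ℝ) ≤ Fintype.card ι := by
    have := LinearMap.finrank_range_le φ
    rw [Module.finrank_fintype_fun_eq_card] at this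
    exact_mod_cast this
  have hex : ∀ i, ∃ w, φ w = e i := fun i ↦ (e i).2
  choose w hw using hex
  set F : ℝ → ℝ := fun t ↦ ∑ i, ‖∑ j, w i j * h j t‖ ^ 2 with hF
  have hFi : ∫ t in a..b, F t = Module.finrank ℂ (LinearMap.range φ) := by
    rw [hF, intervalIntegral.integral_finsetSum (f := fun i t ↦ ‖∑ j, w i j * h j t‖ ^ 2)
      fun i _ ↦ ((hcont (w i)).norm.pow 2).intervalIntegrable _ _]
    have : ∀ i, ‖e i‖ = 1 := fun i ↦ e.norm_eq_one i
    simp [← hnorm, hw, ← Submodule.coe_norm, this]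
  have hFc : Continuous F := continuous_finsetSum _ fun i _ ↦ (hcont (w i)).norm.pow 2
  obtain ⟨x, hx, hFx⟩ : ∃ x ∈ Set.Icc a b, F x ≤ Fintype.card ι / (b - a) := by
    by_contra! hcon
    have : ∫ t in a..b, (Fintype.card ι / (b - a) : ℝ) < ∫ t in a..b, F t :=
      intervalIntegral.integral_lt_integral_of_continuousOn_of_le_of_exists_lt hab
        continuousOn_const hFc.continuousOn
        (fun t ht ↦ (hcon t (Set.Ioc_subset_Icc_self ht)).le)
        ⟨a, Set.left_mem_Icc.2 hab.le, hcon a (Set.left_mem_Icc.2 hab.le)⟩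
    rw [intervalIntegral.integral_const, hFi, smul_eq_mul,
      mul_div_cancel₀ _ (sub_pos.2 hab).ne'] at this
    linarith
  refine ⟨x, hx, fun v ↦ ?_⟩
  let V : LinearMap.range φ := ⟨φ v, v, rfl⟩
  have hsum : φ v = φ (∑ i, (inner ℂ (e i) V : ℂ) • w i) := by
    rw [map_sum]
    have := congrArg (Subtype.val) (e.sum_repr' V)
    simpa [hw] using this.symm
  have hval := heq _ _ hsum hx
  have hval' : ∑ i, v i * h i x = ∑ i, (inner ℂ (e i) V : ℂ) * ∑ j, w i j * h j x := by
    refine hval.trans ?_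
    simp only [Finset.sum_apply, Pi.smul_apply, smul_eq_mul, Finset.sum_mul, Finset.mul_sum]
    rw [Finset.sum_comm]
    simp [mul_assoc]
  have hV : ∑ i, ‖(inner ℂ (e i) V : ℂ)‖ ^ 2 = ∫ t in a..b, ‖∑ i, v i * h i t‖ ^ 2 := by
    rw [e.sum_sq_norm_inner_right, ← hnorm]; rfl
  calc ‖∑ i, v i * h i x‖ ^ 2
      ≤ (∑ i, ‖(inner ℂ (e i) V : ℂ)‖ * ‖∑ j, w i j * h j x‖) ^ 2 := by
        rw [hval']
        gcongr
        exact (norm_sum_le _ _).trans_eq (by simp)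
    _ ≤ (∑ i, ‖(inner ℂ (e i) V : ℂ)‖ ^ 2) * F x := Finset.sum_mul_sq_le_sq_mul_sq _ _ _
    _ ≤ _ := by
        rw [hV, mul_comm]
        gcongr
        exact intervalIntegral.integral_nonneg hab.le fun t _ ↦ by positivity

/-- Truncated Blaschke-type factor: it vanishes at `1` and is at most `1 + O(1/k)` on the circle. -/
lemma norm_one_sub_geom_le {r q α : ℝ} {M : ℕ} (hr0 : 0 < r) (hr1 : r < 1) (hq : q = r ^ M)
    (hq1 : q < 1) (hα : α = (1 - r) / (1 - q)) {s : ℂ} (hs : ‖s‖ = 1) :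
    ‖1 - (α : ℂ) * ∑ j ∈ Finset.range M, (r : ℂ) ^ j * s ^ (j + 1)‖ ≤
      2 / (1 + r) + 2 * q / (1 - q) := by
  have hq0 : 0 < q := hq ▸ pow_pos hr0 M
  have hgeom : (∑ j ∈ Finset.range M, (r : ℂ) ^ j * s ^ (j + 1)) * (1 - r * s) =
      s * (1 - (r * s) ^ M) := by
    rw [← geom_sum_mul_neg, ← mul_assoc, Finset.mul_sum]
    congr 1
    exact Finset.sum_congr rfl fun j _ ↦ by ring
  have hαe : α = (1 - r) + (1 - r) * (q / (1 - q)) := by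
    rw [hα]; field_simp [(sub_pos.2 hq1).ne']; ring
  have hα0 : 0 ≤ α := hα ▸ div_nonneg (by linarith) (by linarith)
  have hαq : α * q = (1 - r) * (q / (1 - q)) := by rw [hα]; ring
  have hkey : (1 - (α : ℂ) * ∑ j ∈ Finset.range M, (r : ℂ) ^ j * s ^ (j + 1)) * (1 - r * s) =
      (1 - s) + (-((α * q : ℝ) : ℂ) * s + ((α * q : ℝ) : ℂ) * s ^ (M + 1)) := by
    rw [sub_mul, mul_assoc, hgeom]
    have h1 : (α : ℂ) = (1 - r) + ((α * q : ℝ) : ℂ) := by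
      rw [hαq]; exact_mod_cast hαe
    have h2 : ((α * q : ℝ) : ℂ) = α * r ^ M := by rw [hq]; push_cast; ring
    calc _ = 1 - r * s - (α : ℂ) * s + (α * r ^ M) * s ^ (M + 1) := by ring
      _ = 1 - r * s - ((1 - r) + ((α * q : ℝ) : ℂ)) * s + ((α * q : ℝ) : ℂ) * s ^ (M + 1) := by
        rw [← h2, ← h1]
      _ = _ := by ring
  have hden : 1 - r ≤ ‖1 - (r : ℂ) * s‖ := by
    have := norm_sub_norm_le (1 : ℂ) (r * s)
    simpa [hs, abs_of_pos hr0] using this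
  have hpos : 0 < ‖1 - (r : ℂ) * s‖ := by linarith
  have hmain : ‖1 - s‖ ≤ 2 / (1 + r) * ‖1 - (r : ℂ) * s‖ := by
    have hs2 : s.re ^ 2 + s.im ^ 2 = 1 := by
      have := Complex.sq_norm s
      rw [hs, Complex.normSq_apply] at this; nlinarith
    rw [div_mul_eq_mul_div, le_div_iff₀ (by linarith)]
    refine le_of_sq_le_sq ?_ (by positivity)
    rw [mul_pow, mul_pow, Complex.sq_norm, Complex.sq_norm, Complex.normSq_apply,
      Complex.normSq_apply]
    simp
    nlinarith [mul_nonneg (sq_nonneg (1 - r)) (by nlinarith [sq_nonneg s.im] : 0 ≤ 1 + s.re)]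
  have hrest : ‖-((α * q : ℝ) : ℂ) * s + ((α * q : ℝ) : ℂ) * s ^ (M + 1)‖ ≤
      2 * q / (1 - q) * ‖1 - (r : ℂ) * s‖ := by
    refine (norm_add_le _ _).trans ?_
    rw [norm_mul, norm_neg, norm_mul, norm_pow, hs, Complex.norm_real, Real.norm_eq_abs,
      abs_of_nonneg (mul_nonneg hα0 hq0.le), hαq]
    have : 0 ≤ q / (1 - q) := div_nonneg hq0.le (by linarith)
    rw [mul_div_assoc, one_pow]
    nlinarith [mul_le_mul_of_nonneg_left hden this]
  refine le_of_mul_le_mul_right ?_ hpos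
  rw [← norm_mul, hkey, add_mul]
  exact (norm_add_le _ _).trans (add_le_add hmain hrest)

open Polynomial in
/-- Given `k` points of the unit circle there is a polynomial of degree `O(k² log k)` vanishing at
them, with constant coefficient `1` and bounded on the unit circle by an absolute constant. -/
lemma exists_polynomial_vanishing_bounded {k : ℕ} (hk : 2 ≤ k) (z : ℕ → ℂ) (hz : ∀ j, ‖z j‖ = 1) :
    ∃ P : ℂ[X], P.coeff 0 = 1 ∧ P.natDegree ≤ k * ⌈2 * k * Real.log k⌉₊ ∧
      (∀ j ∈ Finset.range k, P.eval (z j) = 0) ∧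
      ∀ u : ℂ, ‖u‖ = 1 → ‖P.eval u‖ ≤ Real.exp 3 := by
  set M := ⌈2 * k * Real.log k⌉₊ with hM
  have hk' : (2 : ℝ) ≤ k := by exact_mod_cast hk
  have hk0 : (0 : ℝ) < k := by linarith
  set r : ℝ := 1 - 1 / k with hr
  have hinv : 1 / (k : ℝ) ≤ 1 / 2 := one_div_le_one_div_of_le (by norm_num) hk'
  have hinv0 : 0 < 1 / (k : ℝ) := by positivity
  set q : ℝ := r ^ M with hq
  set α : ℝ := (1 - r) / (1 - q) with hα
  have hqk : q ≤ (1 / k) * (1 / k) := by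
    calc q ≤ Real.exp (-(1 / k)) ^ M := by
          refine pow_le_pow_left₀ (by linarith) ?_ M
          have := Real.add_one_le_exp (-(1 / (k : ℝ)))
          linarith
      _ = Real.exp (-(M / k)) := by rw [← Real.exp_nat_mul]; congr 1; ring
      _ ≤ Real.exp (-(2 * Real.log k)) := by
          gcongr
          rw [le_div_iff₀ hk0]
          have := Nat.le_ceil (2 * k * Real.log k)
          linarith
      _ = (1 / k) * (1 / k) := by
          rw [show -(2 * Real.log k) = -Real.log k + -Real.log k by ring, Real.exp_add,
            Real.exp_neg, Real.exp_log hk0]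
          ring
  have hq0 : 0 ≤ q := pow_nonneg (by linarith) M
  have hq4 : q ≤ 1 / 4 := by nlinarith
  have hfac : ∀ s : ℂ, ‖s‖ = 1 →
      ‖1 - (α : ℂ) * ∑ j ∈ Finset.range M, (r : ℂ) ^ j * s ^ (j + 1)‖ ≤ Real.exp (3 / k) := by
    intro s hs
    refine (norm_one_sub_geom_le (by linarith) (by linarith) hq (by linarith) hα hs).trans ?_
    have h1 : 2 / (1 + r) ≤ 1 + 1 / k := by
      rw [div_le_iff₀ (by linarith), hr]
      nlinarith
    have h2 : 2 * q / (1 - q) ≤ 2 * (1 / k) := by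
      rw [div_le_iff₀ (by linarith)]
      nlinarith
    have h3 := Real.add_one_le_exp (3 / (k : ℝ))
    have h4 : 3 / (k : ℝ) = 3 * (1 / k) := by ring
    linarith
  have hone : α * ∑ j ∈ Finset.range M, r ^ j = 1 := by
    have h1 := geom_sum_mul_neg r M
    have h2 : 1 - q ≠ 0 := by linarith
    rw [hα, div_mul_eq_mul_div, mul_comm, h1]
    exact div_self h2
  let p : ℕ → ℂ[X] := fun i ↦ 1 - C (α : ℂ) * ∑ j ∈ Finset.range M,
    C ((r : ℂ) ^ j * (z i)⁻¹ ^ (j + 1)) * X ^ (j + 1)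
  have heval : ∀ i u, (p i).eval u =
      1 - (α : ℂ) * ∑ j ∈ Finset.range M, (r : ℂ) ^ j * ((z i)⁻¹ * u) ^ (j + 1) := fun i u ↦ by
    simp [p, eval_finsetSum, mul_pow, mul_assoc]
  refine ⟨∏ i ∈ Finset.range k, p i, ?_, ?_, ?_, ?_⟩
  · rw [coeff_zero_eq_eval_zero, eval_prod]
    exact Finset.prod_eq_one fun i _ ↦ by simp [heval]
  · refine (natDegree_prod_le _ _).trans ?_
    refine (Finset.sum_le_card_nsmul _ _ M fun i _ ↦ ?_).trans (by simp)
    refine (natDegree_sub_le _ _).trans (max_le (by simp) ?_)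
    refine (natDegree_C_mul_le _ _).trans (natDegree_sum_le_of_forall_le _ _ fun j hj ↦ ?_)
    have := Finset.mem_range.1 hj
    exact (natDegree_C_mul_X_pow_le _ _).trans (by omega)
  · intro j hj
    rw [eval_prod]
    refine Finset.prod_eq_zero hj ?_
    have hzj : z j ≠ 0 := fun h0 ↦ by simpa [h0] using hz j
    rw [heval, inv_mul_cancel₀ hzj]
    simp only [one_pow, mul_one]
    rw [sub_eq_zero]
    exact_mod_cast hone.symm
  · intro u hu
    rw [eval_prod, norm_prod]
    calc ∏ i ∈ Finset.range k, ‖(p i).eval u‖ ≤ ∏ i ∈ Finset.range k, Real.exp (3 / k) := by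
          refine Finset.prod_le_prod (fun _ _ ↦ norm_nonneg _) fun i _ ↦ ?_
          rw [heval]
          exact hfac _ (by simp [hz, hu])
      _ = Real.exp 3 := by
          rw [Finset.prod_const, Finset.card_range, ← Real.exp_nat_mul, mul_div_cancel₀ _ hk0.ne']

/-- The `ℓ²` norm of the coefficients of a polynomial is at most its supremum on the unit circle. -/
lemma Polynomial.sum_sq_norm_coeff_le {P : Polynomial ℂ} {B : ℝ}
    (hB : ∀ u : ℂ, ‖u‖ = 1 → ‖P.eval u‖ ≤ B)
    (s : Finset ℕ) : ∑ i ∈ s, ‖P.coeff i‖ ^ 2 ≤ B ^ 2 := by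
  have h1 : ∑ i ∈ s, ‖P.coeff i‖ ^ 2 ≤ ∑ i ∈ P.support, ‖P.coeff i‖ ^ 2 := by
    classical
    rw [← Finset.sum_filter_add_sum_filter_not s (· ∈ P.support)]
    rw [Finset.sum_eq_zero (s := s.filter (¬ · ∈ P.support)) (by simp +contextual), add_zero]
    exact Finset.sum_le_sum_of_subset_of_nonneg (fun i hi ↦ (Finset.mem_filter.1 hi).2)
      fun _ _ _ ↦ by positivity
  refine h1.trans ?_
  rw [P.sum_sq_norm_coeff_eq_circleAverage]
  refine circleAverage_mono_on_of_le_circle ?_ fun u hu ↦ ?_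
  · apply ContinuousOn.circleIntegrable'
    fun_prop
  · have := hB u (by simpa using hu)
    gcongr

/-- The exponential sum with coefficients `v 0, …, v (k - 1)` and frequencies `f 0, …, f (k - 1)`. -/
noncomputable def fourierSum (k : ℕ) (v : ℕ → ℂ) (f : ℕ → ℝ) (t : ℝ) : ℂ :=
  ∑ j ∈ Finset.range k,
    v j * Complex.exp (2 * (Real.pi : ℂ) * Complex.I * (f j : ℂ) * (t : ℂ))

lemma continuous_fourierSum (k : ℕ) (v : ℕ → ℂ) (f : ℕ → ℝ) : Continuous (fourierSum k v f) := by
  unfold fourierSum; fun_prop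

lemma fourierSum_add (k : ℕ) (v : ℕ → ℂ) (f : ℕ → ℝ) (t s : ℝ) :
    fourierSum k v f (t + s) = fourierSum k
      (fun j ↦ v j * Complex.exp (2 * (Real.pi : ℂ) * Complex.I * (f j : ℂ) * (s : ℂ))) f t := by
  refine Finset.sum_congr rfl fun j _ ↦ ?_
  change _ = v j * _ * _
  rw [mul_assoc (v j), ← Complex.exp_add]
  congr 2
  push_cast
  ring

/-- Pointwise bound by the mean square over a symmetric interval: the space of exponential sums with
fixed frequencies is translation invariant, so the average point may be moved to `y`. -/
lemma sq_norm_fourierSum_le (k : ℕ) (v : ℕ → ℂ) (f : ℕ → ℝ) (y : ℝ) {ρ : ℝ} (hρ : 0 < ρ) :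
    ‖fourierSum k v f y‖ ^ 2 ≤ k / ρ * ∫ t in (y - ρ)..(y + ρ), ‖fourierSum k v f t‖ ^ 2 := by
  obtain ⟨x, hx, hle⟩ := exists_sq_norm_sum_le_integral
    (fun (j : Fin k) (t : ℝ) ↦ Complex.exp (2 * (Real.pi : ℂ) * Complex.I * (f j : ℂ) * (t : ℂ)))
    (fun j ↦ by fun_prop) (show -(ρ / 2) < ρ / 2 by linarith)
  have h := hle fun j ↦
    v j * Complex.exp (2 * (Real.pi : ℂ) * Complex.I * (f j : ℂ) * ((y - x : ℝ) : ℂ))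
  have hsum : ∀ t : ℝ, ∑ j : Fin k,
      v j * Complex.exp (2 * (Real.pi : ℂ) * Complex.I * (f j : ℂ) * ((y - x : ℝ) : ℂ)) *
        Complex.exp (2 * (Real.pi : ℂ) * Complex.I * (f j : ℂ) * (t : ℂ)) =
      fourierSum k v f (t + (y - x)) := fun t ↦ by
    rw [fourierSum_add, fourierSum, Finset.sum_range]
  simp only [hsum] at h
  rw [intervalIntegral.integral_comp_add_right (fun t ↦ ‖fourierSum k v f t‖ ^ 2), Fintype.card_fin,
    add_sub_cancel, show ρ / 2 - -(ρ / 2) = ρ by ring] at h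
  refine h.trans ?_
  gcongr
  refine intervalIntegral.integral_mono_interval (by linarith [hx.1, hx.2]) (by linarith)
    (by linarith [hx.1, hx.2]) (.of_forall fun t ↦ by positivity)
    (((continuous_fourierSum k v f).norm.pow 2).intervalIntegrable _ _)

lemma sq_norm_fourierSum_le_div_one_sub_abs (k : ℕ) (v : ℕ → ℂ) (f : ℕ → ℝ) {y : ℝ} (hy : |y| < 1) :
    ‖fourierSum k v f y‖ ^ 2 ≤
      k / (1 - |y|) * ∫ t in (-1 : ℝ)..1, ‖fourierSum k v f t‖ ^ 2 := by
  have hy0 : 0 < 1 - |y| := by linarith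
  refine (sq_norm_fourierSum_le k v f y hy0).trans ?_
  gcongr
  refine intervalIntegral.integral_mono_interval (by linarith [neg_abs_le y]) (by linarith)
    (by linarith [le_abs_self y]) (.of_forall fun t ↦ by positivity)
    (((continuous_fourierSum k v f).norm.pow 2).intervalIntegrable _ _)

lemma sum_coeff_mul_fourierSum_eq_zero {k : ℕ} (v : ℕ → ℂ) (f : ℕ → ℝ) (x h : ℝ)
    {P : Polynomial ℂ} {m : ℕ} (hdeg : P.natDegree ≤ m)
    (hP : ∀ j ∈ Finset.range k,
      P.eval (Complex.exp (2 * (Real.pi : ℂ) * Complex.I * (f j : ℂ) * (h : ℂ))) = 0) :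
    ∑ i ∈ Finset.range (m + 1), P.coeff i * fourierSum k v f (x + i * h) = 0 := by
  simp only [fourierSum, Finset.mul_sum]
  rw [Finset.sum_comm]
  refine Finset.sum_eq_zero fun j hj ↦ ?_
  have h0 := hP j hj
  rw [Polynomial.eval_eq_sum_range' (Nat.lt_succ_of_le hdeg)] at h0
  have : ∀ i ∈ Finset.range (m + 1), P.coeff i * (v j * Complex.exp
      (2 * (Real.pi : ℂ) * Complex.I * (f j : ℂ) * ((x + i * h : ℝ) : ℂ))) =
      (v j * Complex.exp (2 * (Real.pi : ℂ) * Complex.I * (f j : ℂ) * (x : ℂ))) *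
      (P.coeff i * Complex.exp (2 * (Real.pi : ℂ) * Complex.I * (f j : ℂ) * (h : ℂ)) ^ i) := by
    intro i _
    rw [← Complex.exp_nat_mul]
    have : (2 * (Real.pi : ℂ) * Complex.I * (f j : ℂ) * ((x + i * h : ℝ) : ℂ)) =
      2 * (Real.pi : ℂ) * Complex.I * (f j : ℂ) * (x : ℂ) +
        i * (2 * (Real.pi : ℂ) * Complex.I * (f j : ℂ) * (h : ℂ)) := by push_cast; ring
    rw [this, Complex.exp_add]
    ring
  rw [Finset.sum_congr rfl this, ← Finset.mul_sum, h0, mul_zero]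

/-- Bound up to the endpoints: `x` is the end of an arithmetic progression running towards `0`, along
which a linear recurrence with square-summable coefficients expresses the value at `x`. -/
lemma sq_norm_fourierSum_le_of_mem_Icc {k : ℕ} (hk : 2 ≤ k) (v : ℕ → ℂ) (f : ℕ → ℝ) {x : ℝ}
    (hx : x ∈ Set.Icc (-1 : ℝ) 1) :
    ‖fourierSum k v f x‖ ^ 2 ≤ 42 * Real.exp 3 ^ 2 * (k : ℝ) ^ 3 * Real.log k ^ 2 *
      ∫ t in (-1 : ℝ)..1, ‖fourierSum k v f t‖ ^ 2 := by
  set I := ∫ t in (-1 : ℝ)..1, ‖fourierSum k v f t‖ ^ 2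
  have hI : 0 ≤ I := intervalIntegral.integral_nonneg (by norm_num) fun t _ ↦ by positivity
  set m := k * ⌈2 * k * Real.log k⌉₊ with hm
  have hk' : (2 : ℝ) ≤ k := by exact_mod_cast hk
  have hlog : 0.69 ≤ Real.log k := by
    linarith [Real.log_le_log (by norm_num) hk', Real.log_two_gt_d9]
  have hlog' : Real.log k ≤ k := (Real.log_le_sub_one_of_pos (by linarith)).trans (by linarith)
  have hm1 : (m : ℝ) ≤ 3 * k ^ 2 * Real.log k := by
    have h1 := (Nat.ceil_lt_add_one (show 0 ≤ 2 * k * Real.log k by positivity)).le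
    have h2 : (1 : ℝ) ≤ k * Real.log k := by nlinarith
    rw [hm]
    push_cast
    nlinarith
  have hm0 : 0 < m := by
    rw [hm]
    have : 0 < 2 * k * Real.log k := by positivity
    exact Nat.mul_pos (by omega) (Nat.ceil_pos.2 this)
  have hm0' : (0 : ℝ) < m := by exact_mod_cast hm0
  have hm2 : 1 + Real.log m ≤ 7 * Real.log k := by
    have : (m : ℝ) ≤ k ^ 5 := by
      calc (m : ℝ) ≤ 3 * k ^ 2 * k := hm1.trans (by gcongr)
        _ ≤ (k * k) * k ^ 2 * k := by gcongr; nlinarith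
        _ = k ^ 5 := by ring
    have h2 := Real.log_le_log hm0' this
    rw [Real.log_pow] at h2
    push_cast at h2
    linarith
  obtain ⟨h, hh, hxh⟩ : ∃ h : ℝ, |h| = 1 / (2 * m) ∧
      ∀ i : ℕ, i ≤ m → i * (1 / (2 * m)) ≤ 1 - |x + i * h| := by
    have hhalf : ∀ i : ℕ, i ≤ m → (i : ℝ) * (1 / (2 * m)) ≤ 1 / 2 := fun i hi ↦ by
      have : (i : ℝ) ≤ m := by exact_mod_cast hi
      rw [mul_one_div, div_le_div_iff₀ (by positivity) (by positivity)]
      linarith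
    rcases le_total 0 x with h0 | h0
    · refine ⟨-(1 / (2 * m)), by rw [abs_neg, abs_of_nonneg (by positivity)], fun i hi ↦ ?_⟩
      have := hhalf i hi
      have h3 : |x + i * -(1 / (2 * m))| ≤ 1 - i * (1 / (2 * m)) :=
        abs_le.2 ⟨by linarith [hx.2], by linarith [hx.2]⟩
      linarith
    · refine ⟨1 / (2 * m), abs_of_nonneg (by positivity), fun i hi ↦ ?_⟩
      have := hhalf i hi
      have h3 : |x + i * (1 / (2 * m))| ≤ 1 - i * (1 / (2 * m)) :=
        abs_le.2 ⟨by linarith [hx.1], by linarith [hx.1]⟩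
      linarith
  obtain ⟨P, hP0, hPd, hPz, hPB⟩ := exists_polynomial_vanishing_bounded hk
    (fun j ↦ Complex.exp (2 * (Real.pi : ℂ) * Complex.I * (f j : ℂ) * (h : ℂ))) fun j ↦ by
      rw [show 2 * (Real.pi : ℂ) * Complex.I * (f j : ℂ) * (h : ℂ) =
        ((2 * Real.pi * f j * h : ℝ) : ℂ) * Complex.I by push_cast; ring,
        Complex.norm_exp_ofReal_mul_I]
  have hzero := sum_coeff_mul_fourierSum_eq_zero v f x h hPd hPz
  rw [Finset.sum_range_succ', hP0] at hzero
  simp only [Nat.cast_zero, zero_mul, add_zero, one_mul] at hzero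
  have hnode : ∀ i ∈ Finset.range m, ‖fourierSum k v f (x + (i + 1 : ℕ) * h)‖ ^ 2 ≤
      2 * k * m * I * ((i + 1 : ℕ) : ℝ)⁻¹ := fun i hi ↦ by
    have hi := Finset.mem_range.1 hi
    have hpos : 0 < ((i + 1 : ℕ) : ℝ) * (1 / (2 * m)) := by positivity
    have h1 := hxh (i + 1) (by omega)
    refine (sq_norm_fourierSum_le_div_one_sub_abs k v f (by linarith)).trans ?_
    calc _ ≤ k / (((i + 1 : ℕ) : ℝ) * (1 / (2 * m))) * I := by gcongr
      _ = _ := by field_simp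
  calc ‖fourierSum k v f x‖ ^ 2
      = ‖∑ i ∈ Finset.range m, P.coeff (i + 1) * fourierSum k v f (x + (i + 1 : ℕ) * h)‖ ^ 2 := by
        rw [← norm_neg, ← eq_neg_of_add_eq_zero_left hzero]
    _ ≤ (∑ i ∈ Finset.range m, ‖P.coeff (i + 1)‖ * ‖fourierSum k v f (x + (i + 1 : ℕ) * h)‖) ^ 2 := by
        gcongr
        exact (norm_sum_le _ _).trans_eq (by simp)
    _ ≤ (∑ i ∈ Finset.range m, ‖P.coeff (i + 1)‖ ^ 2) *
          ∑ i ∈ Finset.range m, ‖fourierSum k v f (x + (i + 1 : ℕ) * h)‖ ^ 2 :=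
        Finset.sum_mul_sq_le_sq_mul_sq _ _ _
    _ ≤ Real.exp 3 ^ 2 * (2 * k * m * I * (1 + Real.log m)) := by
        gcongr
        · have := Polynomial.sum_sq_norm_coeff_le hPB (Finset.range (m + 1))
          rw [Finset.sum_range_succ'] at this
          nlinarith [sq_nonneg ‖P.coeff 0‖]
        · refine (Finset.sum_le_sum hnode).trans ?_
          rw [← Finset.mul_sum]
          gcongr
          have := harmonic_le_one_add_log m
          rw [harmonic] at this
          push_cast at this ⊢
          exact this
    _ ≤ Real.exp 3 ^ 2 * (2 * k * (3 * k ^ 2 * Real.log k) * I * (7 * Real.log k)) := by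
        gcongr
    _ = _ := by ring

lemma one_div_le_normalizing_constant {k : ℕ} (hk : 2 ≤ k) {c : ℝ} {D : ℝ → ℝ} (hc : 0 < c)
    (hD₁ : ∀ x : ℝ, |x| ≤ 1 - 1 / ((k : ℝ) ^ 2 * (Real.log k) ^ 2) →
      D x = c / ((1 - |x|) * Real.log k))
    (hD₂ : ∀ x : ℝ, 1 - 1 / ((k : ℝ) ^ 2 * (Real.log k) ^ 2) < |x| → |x| ≤ 1 →
      D x = c * (k : ℝ) ^ 2 * Real.log k)
    (hD : (∫ x in (-1 : ℝ)..1, D x) = 1) : 1 / 24 ≤ c := by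
  have hk' : (2 : ℝ) ≤ k := by exact_mod_cast hk
  set L := Real.log k with hL
  have hlog : 0.69 ≤ L := by
    linarith [Real.log_le_log (by norm_num) hk', Real.log_two_gt_d9]
  have hlog' : L ≤ k := (Real.log_le_sub_one_of_pos (by linarith)).trans (by linarith)
  set δ : ℝ := 1 / ((k : ℝ) ^ 2 * L ^ 2) with hδ
  have hδ0 : 0 < δ := by positivity
  have hint : IntervalIntegrable D volume (-1) 1 := by
    by_contra hcon
    rw [intervalIntegral.integral_undef hcon] at hD
    norm_num at hD
  set E : ℝ → ℝ := fun x ↦ 2 * c / L * ((1 + x + δ)⁻¹ + (1 - x + δ)⁻¹) with hE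
  have hDE : ∀ x ∈ Set.Icc (-1 : ℝ) 1, D x ≤ E x := by
    intro x hx
    have hx1 : |x| ≤ 1 := abs_le.2 hx
    have h1 : D x ≤ 2 * c / L * (1 - |x| + δ)⁻¹ := by
      have hpos : 0 < 1 - |x| + δ := by linarith
      rcases le_or_gt |x| (1 - δ) with h | h
      · rw [hD₁ x h, ← div_eq_mul_inv, div_div, div_le_div_iff₀ (by nlinarith) (by positivity)]
        have : 0 ≤ c * L := by positivity
        nlinarith
      · have h2 : c * (k : ℝ) ^ 2 * L = c / L * δ⁻¹ := by
          rw [hδ]; field_simp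
        rw [hD₂ x h hx1, h2, mul_div_assoc, mul_assoc, mul_left_comm]
        gcongr
        rw [← div_eq_mul_inv, inv_eq_one_div, div_le_div_iff₀ hδ0 hpos]
        linarith
    refine h1.trans ?_
    have ha : 0 ≤ (1 + x + δ)⁻¹ := inv_nonneg.2 (by linarith [hx.1])
    have hb : 0 ≤ (1 - x + δ)⁻¹ := inv_nonneg.2 (by linarith [hx.2])
    simp only [hE]
    gcongr
    rcases abs_cases x with ⟨h, _⟩ | ⟨h, _⟩ <;> rw [h]
    · linarith
    · rw [sub_neg_eq_add]; linarith
  have hEc : ContinuousOn (fun x : ℝ ↦ (1 + x + δ)⁻¹ + (1 - x + δ)⁻¹) (Set.uIcc (-1) 1) := by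
    rw [Set.uIcc_of_le (by norm_num)]
    refine ContinuousOn.add (ContinuousOn.inv₀ (by fun_prop) fun x hx ↦ ?_)
      (ContinuousOn.inv₀ (by fun_prop) fun x hx ↦ ?_)
    · linarith [hx.1]
    · linarith [hx.2]
  have hEint : ∫ x in (-1 : ℝ)..1, ((1 + x + δ)⁻¹ + (1 - x + δ)⁻¹) =
      2 * Real.log ((2 + δ) / δ) := by
    rw [intervalIntegral.integral_eq_sub_of_hasDerivAt
      (f := fun x ↦ Real.log (1 + x + δ) - Real.log (1 - x + δ)) _ hEc.intervalIntegrable]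
    · rw [Real.log_div (by positivity) hδ0.ne']
      ring_nf
    · intro x hx
      rw [Set.uIcc_of_le (by norm_num)] at hx
      have h1 : HasDerivAt (fun x : ℝ ↦ 1 + x + δ) 1 x :=
        ((hasDerivAt_id x).const_add 1).add_const δ
      have h2 : HasDerivAt (fun x : ℝ ↦ 1 - x + δ) (-1) x :=
        ((hasDerivAt_id x).const_sub 1).add_const δ
      exact ((h1.log (by linarith [hx.1])).sub (h2.log (by linarith [hx.2]))).congr_deriv (by ring)
  have hlogb : Real.log ((2 + δ) / δ) ≤ 6 * L := by
    have h1 : (2 + δ) / δ = 2 * (k ^ 2 * L ^ 2) + 1 := by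
      rw [add_div, div_self hδ0.ne', hδ]; field_simp
    have h2 : (2 + δ) / δ ≤ k ^ 6 := by
      rw [h1]
      have h3 : (k : ℝ) ^ 2 * L ^ 2 ≤ k ^ 2 * k ^ 2 := by gcongr
      have h4 : (16 : ℝ) ≤ k ^ 4 := by
        calc (16 : ℝ) = 2 ^ 4 := by norm_num
          _ ≤ k ^ 4 := by gcongr
      nlinarith
    have h3 := Real.log_le_log (by positivity) h2
    rw [Real.log_pow] at h3
    exact_mod_cast h3
  have hfin : 1 ≤ 2 * c / L * (2 * (6 * L)) := by
    calc (1 : ℝ) = ∫ x in (-1 : ℝ)..1, D x := hD.symm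
      _ ≤ ∫ x in (-1 : ℝ)..1, E x :=
        intervalIntegral.integral_mono_on (by norm_num) hint
          (hEc.intervalIntegrable.const_mul _) hDE
      _ = 2 * c / L * (2 * Real.log ((2 + δ) / δ)) := by
        rw [hE, intervalIntegral.integral_const_mul, hEint]
      _ ≤ _ := by gcongr
  have : 2 * c / L * (2 * (6 * L)) = 24 * c := by field_simp; ring
  linarith

/-- There is an absolute constant `A` such that for every `k ≥ 2`, the
biased density `D_k` (with normalizing constant `c_k > 0`, `∫_{-1}^1 D_k = 1`) satisfies
`|g x|² ≤ A·k·(log k)²·2·D_k(x)·‖g‖₂²` for every `k`-Fourier-sparse `g` and every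
`x ∈ [−1,1]`. -/
theorem biased_density_bound :
    ∃ A : ℝ, 0 < A ∧
      ∀ (k : ℕ), 2 ≤ k →
        ∀ (c : ℝ) (D : ℝ → ℝ), 0 < c →
          (∀ x : ℝ, |x| ≤ 1 - 1 / ((k : ℝ) ^ 2 * (Real.log k) ^ 2) →
            D x = c / ((1 - |x|) * Real.log k)) →
          (∀ x : ℝ, 1 - 1 / ((k : ℝ) ^ 2 * (Real.log k) ^ 2) < |x| → |x| ≤ 1 →
            D x = c * (k : ℝ) ^ 2 * Real.log k) →
          (∫ x in (-1 : ℝ)..1, D x) = 1 →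
          ∀ (v : ℕ → ℂ) (f : ℕ → ℝ) (g : ℝ → ℂ),
            (∀ t : ℝ, g t = ∑ j ∈ Finset.range k,
                v j * Complex.exp (2 * (Real.pi : ℂ) * Complex.I * (f j : ℂ) * (t : ℂ))) →
            ∀ x ∈ Set.Icc (-1 : ℝ) 1,
              ‖g x‖ ^ 2 ≤ A * (k : ℝ) * (Real.log k) ^ 2 * (2 * D x) *
                ((1 / 2) * ∫ y in (-1 : ℝ)..1, ‖g y‖ ^ 2) := by
  refine ⟨2016 * Real.exp 3 ^ 2, by positivity, ?_⟩
  intro k hk c D hc hD₁ hD₂ hD v f g hg x hx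
  have hc' := one_div_le_normalizing_constant hk hc hD₁ hD₂ hD
  obtain rfl : g = fourierSum k v f := funext hg
  set I := ∫ t in (-1 : ℝ)..1, ‖fourierSum k v f t‖ ^ 2
  have hI : 0 ≤ I := intervalIntegral.integral_nonneg (by norm_num) fun t _ ↦ by positivity
  have hk' : (2 : ℝ) ≤ k := by exact_mod_cast hk
  have hlog : 1 / 2 ≤ Real.log k := by
    linarith [Real.log_le_log (by norm_num) hk', Real.log_two_gt_d9]
  have hcL : 1 / 48 ≤ c * Real.log k := by nlinarith
  have hexp : 1 ≤ Real.exp 3 ^ 2 := one_le_pow₀ (Real.one_le_exp (by norm_num))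
  rcases le_or_gt |x| (1 - 1 / ((k : ℝ) ^ 2 * (Real.log k) ^ 2)) with h | h
  · have hpos : 0 < 1 / ((k : ℝ) ^ 2 * (Real.log k) ^ 2) := by positivity
    have hx1 : 0 < 1 - |x| := by linarith
    refine (sq_norm_fourierSum_le_div_one_sub_abs k v f (by linarith)).trans ?_
    rw [hD₁ x h]
    calc k / (1 - |x|) * I = k / (1 - |x|) * I * 1 := (mul_one _).symm
      _ ≤ k / (1 - |x|) * I * (2016 * Real.exp 3 ^ 2 * (c * Real.log k)) := by
        gcongr
        nlinarith
      _ = _ := by field_simp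
  · refine (sq_norm_fourierSum_le_of_mem_Icc hk v f hx).trans ?_
    rw [hD₂ x h (abs_le.2 hx)]
    calc 42 * Real.exp 3 ^ 2 * (k : ℝ) ^ 3 * Real.log k ^ 2 * I
        = 2016 * Real.exp 3 ^ 2 * (k : ℝ) ^ 3 * Real.log k ^ 2 * I * (1 / 48) := by ring
      _ ≤ 2016 * Real.exp 3 ^ 2 * (k : ℝ) ^ 3 * Real.log k ^ 2 * I * (c * Real.log k) := by gcongr
      _ = _ := by ring
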